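/- The collection of all subsets of V of the form {q ∈ V : f q = c}, where f ranges over proper 5-colorings of the 600-cell graph Σ and c over Fin 5, has exactly 25 members. (This is the paper's statement that B(Σ⁶) has 25 vertices, corresponding to the 25 double cosets p^i·𝒯·p^j of the binary tetrahedral group.) -/

import Mathlib

/-- The golden ratio. -/
noncomputable def gr : ℝ := (1 + Real.sqrt 5) / 2

/-- The coefficient 4-tuple of a quaternion with respect to the basis (1, i, j, k). -/
def coords (q : Quaternion ℝ) : Fin 4 → ℝ := ![q.re, q.imI, q.imJ, q.imK]

/-- `x` is a sign, i.e. `x = ±1`. -/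
def IsSign (x : ℝ) : Prop := x = 1 ∨ x = -1

/-- The 120 vertices of the regular 600-cell of circumradius 1: the eight unit quaternions
`±1, ±i, ±j, ±k`, the sixteen quaternions `½(±1 ± i ± j ± k)`, and the ninety-six quaternions
whose coefficient 4-tuple is an even permutation of `(±φ/2, ±1/2, ±1/(2φ), 0)`. -/
noncomputable def V600 : Set (Quaternion ℝ) :=
  {q | (∃ ε : ℝ, IsSign ε ∧
          (coords q = ![ε, 0, 0, 0] ∨ coords q = ![0, ε, 0, 0] ∨
           coords q = ![0, 0, ε, 0] ∨ coords q = ![0, 0, 0, ε])) ∨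
       (∃ ε₀ ε₁ ε₂ ε₃ : ℝ, IsSign ε₀ ∧ IsSign ε₁ ∧ IsSign ε₂ ∧ IsSign ε₃ ∧
          coords q = ![ε₀ / 2, ε₁ / 2, ε₂ / 2, ε₃ / 2]) ∨
       (∃ ε₁ ε₂ ε₃ : ℝ, IsSign ε₁ ∧ IsSign ε₂ ∧ IsSign ε₃ ∧
          ∃ σ : Equiv.Perm (Fin 4), Equiv.Perm.sign σ = 1 ∧
            coords q = ![ε₁ * gr / 2, ε₂ / 2, ε₃ / (2 * gr), 0] ∘ σ)}

/-- The 600-cell graph: distinct vertices are adjacent iff their distance is `φ - 1`. -/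
noncomputable def sigma600 : SimpleGraph V600 :=
  SimpleGraph.fromRel fun q q' => ‖(q : Quaternion ℝ) - (q' : Quaternion ℝ)‖ = gr - 1

namespace SixHundredCell

/-- The elements of `ℤ[φ]` occurring as coordinates of doubled vertices of the 600-cell; the pair
`(a, b)` stands for `a + b φ`. -/
def digit : ℕ → ℤ × ℤ
  | 0 => (0, 0)
  | 1 => (1, 0)
  | 2 => (-1, 0)
  | 3 => (2, 0)
  | 4 => (-2, 0)
  | 5 => (0, 1)
  | 6 => (0, -1)
  | 7 => (-1, 1)
  | _ => (1, -1)

/-- The vertices of the 600-cell, four decimal digits each. -/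
def codes : List ℕ :=
  [3, 725, 825, 2075, 1075, 7205, 8205, 7105, 8105, 2085, 1085, 715, 815, 167, 2121, 1121, 7061,
   8061, 581, 267, 2221, 1221, 681, 6017, 6701, 6801, 8051, 2211, 2111, 5017, 5701, 5801, 7051,
   1211, 1111, 1607, 671, 2607, 1507, 571, 2507, 6027, 5027, 157, 257, 40, 7520, 8520, 2760,
   1760, 168, 6180, 5180, 1860, 2860, 300, 7620, 8620, 268, 6280, 5280, 400, 6270, 6170, 4000,
   2750, 2850, 6018, 30, 8610, 8510, 5270, 5170, 3000, 1750, 1850, 5018, 7610, 7510, 1608, 2608,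
   1508, 2508, 6028, 5028, 158, 258, 7062, 8062, 1122, 582, 2122, 726, 6702, 5702, 1222, 2222,
   572, 682, 826, 6802, 5802, 672, 2212, 2112, 8052, 2076, 7052, 1212, 1112, 1076, 7206, 8206,
   7106, 8106, 2086, 1086, 716, 816, 4]

/-- The neighbourhoods of the vertices, as bit masks. -/
def rows : List ℕ :=
  [8190, 518021, 8062563, 528489281, 33822874785, 113822930005, 206331449901, 842887630099,
   1649552935563, 2199074783567, 4401269932215, 9367659221401, 17673991751801, 2216615442104322,
   2677310830813954, 5141592323466370, 9609731629556742, 18333256883200518, 36241827396903298,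
   531459940409344004, 738592675389375044, 1233990732458034212, 2522016031849316452,
   290536219161445531656, 27672371209223291656, 23634893181063004744, 405828396014595217416,
   668694490470424776776, 1226708491347137923336, 148754544210427110227984,
   14167103956901351687312, 11807069133121328776240, 56963545726029748246544,
   191255842573922875740208, 325843287327632152070288, 757943351322765378453536,
   151708329122969279271008, 1209523753530024793210944, 2724805501219118688534656,
   303412082563359655070080, 4836893131873155327213824, 9671425600669532762030592,
   19352259013795062751527936, 39008259781517885214558208, 77561106345342967692136448,
   464227515049239901840809984, 1859327910609661929571262464, 3718655821174358781368492032,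
   2795036494970592871034544128, 793055337681943388559089664, 9748777809373460380365365248,
   12393907530359719920668786688, 20447785480061924462611693568, 39788166576670487405100859392,
   79547318931651724870571130880, 159701822034778480642118385664, 356527335780999443797204533248,
   396142021500401908864555417600, 1070044421457543804680181121024,
   1346889643098090832768038600704, 2574935240795611889573522571264,
   5387517016064943813514739318784, 11408856611810564172306351915008,
   20292317961052739983090978390016, 1277563792111057086125451509760,
   60847267498287562775589914935296, 50706101381456154256021286551552,
   153395626148073002889871538257920, 202824212150174465529143925669888,
   15211885934113459743806399184896, 20440909752287313028868844027904,
   327053855737244504321453677608960, 649056917181457180910651560689664,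
   2555127666540709601183417761792, 811296423252278809515419523612672,
   486777908107111933784442546421760, 2436444260752482156245541984403456,
   329589234075787726308188360802304, 649195604770152309212391632011264,
   2928629413412004548491961039847424, 5209172457150963866353385355608064,
   11033810944969178595446869729476608, 20789641917409612705819331645145088,
   41539734435926785240885576933048320, 83079345232601554666872192423165952,
   167025801542719168023738777579028480, 332849553403316504299816564933263360,
   83077429075496613321709468596043776, 41539095513795396894840863600934912,
   93461369626870891976533384546484224, 31153947661397804609883530114105344,
   62307578719630561912830060646105088, 820383542270820531654493633509326848,
   62410244491423781776343788859424768, 95410990717598323496482448936534016,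
   85676384379665065958137895162216448, 46732890435729191282924532531200000,
   197976601425426587521438475064705024, 7794268559560431411276981215428608,
   797018008955977541595057029862391808, 46822031712593213306437119019843584,
   87295550375273316159418139118927872, 340430420984477868801956420895375360,
   337627328593967841567409586426609664, 187044549768243751249919079291551744,
   498734311065050181974977547555831808, 1230646621460487618894607730977275904,
   500772693230349142859687564442337280, 336371086848803200758575912269643776,
   177998604986517595753261974543138816, 1260270358240816836350999712023707648,
   1086821232458308368587225727015845888, 1041154159199772124440283105401503744,
   936560730932673258299768631151558656, 882792055029200276290141939497435136,
   690658610177926504258277590100344832, 678896048545866663510837170165252096,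
   1030326283950911860622439738756825088, 840477701040691910235680426409590784,
   663397692093299107482688543011110912]

/-- Five proper 5-colorings; the `v`-th decimal digit is the color of the vertex `v`. -/
def colorings : List ℕ :=
  [12121342400334003313140024402012214331243114204224021301301443202332314140342141212300141300223440013340024334243121210,
   12231323410340334101004402402120243144122124043310114240230332130223344101331220142440220141001303144303024144323132210,
   12113424312043103033004220241004443223112041310332221014444012343043311022312410131244003220420301143030242343424311210,
   12223134302440120011240340410330331422411410223301134224034341032203240411243112420201301433040141030402234143431322210,
   12313132433043020104142002240401412312440221441021210443333130234430301212331241420124020304101240310032342444231313210]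

/-- The doubled coordinates of the vertex `i`. -/
def vec (i : ℕ) (k : Fin 4) : ℤ × ℤ :=
  digit (Nat.ofDigits (10 ^ 4) codes / 10 ^ (4 * i + (k : ℕ)) % 10)

/-- The neighbourhood of the vertex `i`, as a bit mask. -/
def row (i : ℕ) : ℕ := Nat.ofDigits (2 ^ 120) rows >>> (120 * i) % 2 ^ 120

/-- Adjacency of the vertices `i` and `j`. -/
def adj (i j : ℕ) : Bool := (row i).testBit j

/-- The color of the vertex `v` in the coloring `r`. -/
def color (r : Fin 5) (v : ℕ) : Fin 5 := Fin.ofNat 5 (colorings.getD r 0 / 10 ^ v % 10)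

/-- The square of an element of `ℤ[φ]`. -/
def square (p : ℤ × ℤ) : ℤ × ℤ := (p.1 * p.1 + p.2 * p.2, 2 * p.1 * p.2 + p.2 * p.2)

/-- The squared distance of two vectors over `ℤ[φ]`. -/
def sqDist (u w : Fin 4 → ℤ × ℤ) : ℤ × ℤ :=
  square (u 0 - w 0) + square (u 1 - w 1) + square (u 2 - w 2) + square (u 3 - w 3)

theorem adj_eq : ∀ i < 120, ∀ j < 120, adj i j = decide (sqDist (vec i) (vec j) = (8, -4)) := by
  decide +kernel

theorem vec_inj : ∀ i < 120, ∀ j < 120, vec i = vec j → i = j := by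
  decide +kernel

theorem color_proper :
    ∀ i < 120, ∀ j < 120, adj i j → ∀ r, color r i ≠ color r j := by
  decide +kernel

theorem color_inj :
    ∀ r c r' c', (∀ v < 120, color r v = c ↔ color r' v = c') → r = r' ∧ c = c' := by
  decide +kernel

/-- The doubled coordinates of the vertices of the 600-cell, as in the definition of `V600`; note
that `1 / φ = φ - 1`. -/
def IsVertex (u : Fin 4 → ℤ × ℤ) : Prop :=
  (∃ s : ℤˣ, u = ![(2 * (s : ℤ), 0), 0, 0, 0] ∨ u = ![0, (2 * (s : ℤ), 0), 0, 0] ∨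
    u = ![0, 0, (2 * (s : ℤ), 0), 0] ∨ u = ![0, 0, 0, (2 * (s : ℤ), 0)]) ∨
  (∃ s₀ s₁ s₂ s₃ : ℤˣ, u = ![(↑s₀, 0), (↑s₁, 0), (↑s₂, 0), (↑s₃, 0)]) ∨
  ∃ s₁ s₂ s₃ : ℤˣ, ∃ σ : Equiv.Perm (Fin 4), Equiv.Perm.sign σ = 1 ∧
    u = ![(0, ↑s₁), (↑s₂, 0), (-↑s₃, ↑s₃), 0] ∘ σ

instance (u) : Decidable (IsVertex u) := by unfold IsVertex; infer_instance

theorem isVertex_vec : ∀ i < 120, IsVertex (vec i) := by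
  decide +kernel

theorem exists_vec_axis : ∀ s : ℤˣ, (∃ i < 120, vec i = ![(2 * (s : ℤ), 0), 0, 0, 0]) ∧
    (∃ i < 120, vec i = ![0, (2 * (s : ℤ), 0), 0, 0]) ∧
    (∃ i < 120, vec i = ![0, 0, (2 * (s : ℤ), 0), 0]) ∧
    ∃ i < 120, vec i = ![0, 0, 0, (2 * (s : ℤ), 0)] := by
  decide +kernel

theorem exists_vec_half : ∀ s₀ s₁ s₂ s₃ : ℤˣ,
    ∃ i < 120, vec i = ![(↑s₀, 0), (↑s₁, 0), (↑s₂, 0), (↑s₃, 0)] := by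
  decide +kernel

theorem exists_vec_golden : ∀ s₁ s₂ s₃ : ℤˣ, ∀ σ : Equiv.Perm (Fin 4), Equiv.Perm.sign σ = 1 →
    ∃ i < 120, vec i = ![(0, ↑s₁), (↑s₂, 0), (-↑s₃, ↑s₃), 0] ∘ σ := by
  decide +kernel

/-- `f n`, in a form that makes the kernel compute the numeral `n` first. -/
def force {α : Type*} (n : ℕ) (f : ℕ → α) : α :=
  match n with
  | 0 => f 0
  | k + 1 => f (k + 1)

/-- The number `m` with its lowest bit cleared. -/
def clearLowest (m : ℕ) : ℕ := Nat.land m m.pred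

/-- The value `a` or `b` according to the bit `v` of `m`. -/
def ifBit {α : Type*} (m v : ℕ) (a b : α) : α :=
  match Nat.land 1 (Nat.shiftRight m v) with
  | 0 => b
  | _ + 1 => a

/-- One propagation step. In a partial assignment `m`, the bit `v` says that `v` is in the set, and
the bit `120 + v` says that it is not. If `v` is in the set, then its neighbours are not; if `v` is
not in the set and at most three of its neighbours can be, then these are. The arithmetic is written
without notation to speed up the evaluation in the kernel. -/
def settle (m v : ℕ) : ℕ :=
  ifBit m v (Nat.lor m (Nat.shiftLeft (row v) 120)) <|
    ifBit m (Nat.add 120 v)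
      (force (Nat.xor (row v) (Nat.land (row v) (Nat.shiftRight m 120))) fun free =>
        force (clearLowest free) fun free₁ =>
          force (clearLowest free₁) fun free₂ =>
            match clearLowest free₂ with
            | 0 => Nat.lor m free
            | _ + 1 => m)
      m

/-- Propagation through a list of vertices. -/
def propagate : List ℕ → ℕ → ℕ
  | [], m => m
  | v :: l, m => force (settle m v) (propagate l)

/-- Whether the set decided by `m` is a color class of one of the five colorings. -/
def isColorClass (m : ℕ) : Bool :=
  decide (∃ r c : Fin 5, ∀ v : ℕ, v < 120 → m.testBit (if color r v = c then v else 120 + v))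

/-- Whether `f` holds after propagation, or propagation leads to a contradiction. -/
def propagateThen (f : ℕ → Bool) (m : ℕ) : Bool :=
  force (propagate (List.range 120) m) fun m =>
    (Nat.land (Nat.mod m (Nat.pow 2 120)) (Nat.shiftRight m 120)).beq 0 |>.not.or (f m)

/-- Backtracking search, deciding the vertices of a list: whether all complete assignments found
are color classes of the five colorings. -/
def search : List ℕ → ℕ → Bool
  | [], m => isColorClass m
  | v :: l, m =>
    ifBit m v (search l m) <| ifBit m (120 + v) (search l m) <|
      propagateThen (propagateThen (search l)) (Nat.lor m (Nat.shiftLeft 1 v)) &&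
      propagateThen (propagateThen (search l)) (Nat.lor m (Nat.shiftLeft 1 (120 + v)))

theorem search_eq_true : search (List.range 120) 0 = true := by
  decide +kernel

/-- A bound for the size of an independent subset of a list that avoids the bits of `banned`. -/
def indepBound (banned : ℕ) : List ℕ → ℕ
  | [] => 0
  | v :: l =>
    if banned.testBit v then indepBound banned l
    else max (indepBound banned l) (indepBound (banned ||| row v) l + 1)

/-- The neighbours of the vertex `v`. -/
def nbrs (v : ℕ) : List ℕ := (List.range 120).filter (adj v)

theorem indepBound_nbrs : ∀ v < 120, indepBound 0 (nbrs v) ≤ 3 := by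
  decide +kernel

theorem length_nbrs : ∀ v < 120, (nbrs v).length = 12 := by
  decide +kernel

theorem force_eq {α : Type*} (n : ℕ) (f : ℕ → α) : force n f = f n := by
  cases n <;> rfl

theorem ifBit_eq {α : Type*} (m v : ℕ) (a b : α) :
    ifBit m v a b = if m.testBit v then a else b := by
  unfold ifBit Nat.testBit
  change (match 1 &&& (m >>> v) with | 0 => b | _ + 1 => a) = _
  cases 1 &&& (m >>> v) <;> simp

theorem clearLowest_eq (m : ℕ) : clearLowest m = m &&& (m - 1) := rfl

theorem exists_testBit_clearLowest (m : ℕ) :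
    ∃ k, ∀ j ≠ k, m.testBit j → (clearLowest m).testBit j := by
  simp only [clearLowest_eq, Nat.testBit_and, Bool.and_eq_true]
  induction m using Nat.strong_induction_on with
  | _ m ih =>
    rcases Nat.even_or_odd' m with ⟨n, rfl | rfl⟩
    · rcases Nat.eq_zero_or_pos n with rfl | hn
      · exact ⟨0, by simp⟩
      obtain ⟨k, hk⟩ := ih n (by lia)
      refine ⟨k + 1, fun j hj h => ⟨h, ?_⟩⟩
      cases j with
      | zero => simp at h
      | succ j =>
        rw [Nat.testBit_succ] at h ⊢
        rw [show (2 * n - 1) / 2 = n - 1 by lia]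
        exact (hk j (by lia) (by simpa using h)).2
    · refine ⟨0, fun j hj h => ⟨h, ?_⟩⟩
      cases j with
      | zero => exact absurd rfl hj
      | succ j =>
        rw [Nat.testBit_succ] at h ⊢
        rwa [show (2 * n + 1 - 1) / 2 = (2 * n + 1) / 2 by lia]

theorem lt_of_adj {i j : ℕ} (h : adj i j) : j < 120 := by
  rw [adj, row, Nat.testBit_mod_two_pow, Bool.and_eq_true, decide_eq_true_eq] at h
  exact h.1

theorem mem_nbrs {i j : ℕ} : j ∈ nbrs i ↔ adj i j := by
  simpa [nbrs] using lt_of_adj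

theorem nodup_nbrs (i : ℕ) : (nbrs i).Nodup := List.nodup_range.filter _

/-- The constraints on a color class of a proper 5-coloring used by the search: it is independent,
and each vertex outside of it has at least three neighbours in it. -/
structure IsDominating (S : Finset ℕ) : Prop where
  lt : ∀ i ∈ S, i < 120
  indep : ∀ i ∈ S, ∀ j ∈ S, ¬ adj i j
  three_le : ∀ i < 120, i ∉ S → 3 ≤ {j ∈ S | adj i j}.card

/-- The partial assignment `m` is correct for the set `S`. -/
def Describes (m : ℕ) (S : Finset ℕ) : Prop :=
  ∀ v < 120, (m.testBit v → v ∈ S) ∧ (m.testBit (120 + v) → v ∉ S)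

theorem Describes.or {m n : ℕ} {S : Finset ℕ} (hm : Describes m S) (hn : Describes n S) :
    Describes (m ||| n) S := fun v hv => by
  simp only [Nat.testBit_or, Bool.or_eq_true]
  exact ⟨fun h => h.elim (hm v hv).1 (hn v hv).1, fun h => h.elim (hm v hv).2 (hn v hv).2⟩

variable {m : ℕ} {S : Finset ℕ}

theorem Describes.settle (hS : IsDominating S) (h : Describes m S) {v : ℕ} (hv : v < 120) :
    Describes (settle m v) S := by
  simp only [SixHundredCell.settle, ifBit_eq, force_eq]
  split_ifs with h₁ h₂
  · refine h.or (n := row v <<< 120) fun w hw => ⟨?_, ?_⟩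
    · simp [Nat.testBit_shiftLeft, hw]
    · intro hb hwS
      rw [Nat.testBit_shiftLeft] at hb
      exact hS.indep v ((h v hv).1 h₁) w hwS (by simpa [adj] using hb)
  · split
    case _ h₀ =>
      refine h.or (n := row v ^^^ (row v &&& m >>> 120)) ?_
      change clearLowest (clearLowest (clearLowest (row v ^^^ (row v &&& m >>> 120)))) = 0 at h₀
      set free := row v ^^^ (row v &&& m >>> 120) with hfree
      have hbit (w) : free.testBit w = (adj v w && !m.testBit (120 + w)) := by
        simp only [hfree, Nat.testBit_xor, Nat.testBit_and, Nat.testBit_shiftRight, adj]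
        cases (row v).testBit w <;> simp
      obtain ⟨k₁, hk₁⟩ := exists_testBit_clearLowest free
      obtain ⟨k₂, hk₂⟩ := exists_testBit_clearLowest (clearLowest free)
      obtain ⟨k₃, hk₃⟩ := exists_testBit_clearLowest (clearLowest (clearLowest free))
      have hmem (w) (hw : free.testBit w) : w ∈ ({k₁, k₂, k₃} : Finset ℕ) := by
        simp only [Finset.mem_insert, Finset.mem_singleton]
        by_contra! hne
        have := hk₃ w hne.2.2 (hk₂ w hne.2.1 (hk₁ w hne.1 hw))
        simp [h₀] at this
      have hsub : {j ∈ S | adj v j} ⊆ ({k₁, k₂, k₃} : Finset ℕ) := fun w hw => by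
        rw [Finset.mem_filter] at hw
        refine hmem w ?_
        simp only [hbit, hw.2, Bool.true_and, Bool.not_eq_true']
        exact Bool.eq_false_iff.2 fun hb => (h w (hS.lt w hw.1)).2 hb hw.1
      have heq := Finset.eq_of_subset_of_card_le hsub
        (Finset.card_le_three.trans (hS.three_le v hv ((h v hv).2 h₂)))
      refine fun w hw => ⟨fun hb => ?_, fun hb => ?_⟩
      · have := hmem w hb
        rw [← heq] at this
        exact (Finset.mem_filter.1 this).1
      · rw [hbit, Bool.and_eq_true] at hb
        exact absurd (lt_of_adj hb.1) (by lia)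
    case _ => exact h
  · exact h

theorem Describes.propagate (hS : IsDominating S) {l : List ℕ} (hl : ∀ v ∈ l, v < 120)
    (h : Describes m S) : Describes (propagate l m) S := by
  induction l generalizing m with
  | nil => exact h
  | cons v l ih =>
    rw [SixHundredCell.propagate, force_eq]
    rw [List.forall_mem_cons] at hl
    exact ih hl.2 (h.settle hS hl.1)

theorem Describes.of_propagateThen (hS : IsDominating S) (h : Describes m S) {f : ℕ → Bool}
    (hf : propagateThen f m) : ∃ m', Describes m' S ∧ f m' := by
  rw [propagateThen, force_eq] at hf
  have h' := h.propagate hS (l := List.range 120) (by simp)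
  refine ⟨_, h', ?_⟩
  set n := SixHundredCell.propagate (List.range 120) m
  have h0 : n % 2 ^ 120 &&& n >>> 120 = 0 := by
    refine Nat.eq_of_testBit_eq fun w => ?_
    rw [Nat.testBit_and, Nat.testBit_mod_two_pow, Nat.testBit_shiftRight, Nat.zero_testBit]
    by_contra hb
    simp only [Bool.not_eq_false, Bool.and_eq_true, decide_eq_true_eq] at hb
    exact (h' w hb.1.1).2 hb.2 ((h' w hb.1.1).1 hb.1.2)
  change ((n % 2 ^ 120 &&& n >>> 120).beq 0).not.or (f n) at hf
  rw [h0] at hf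
  simpa using hf

theorem describes_one_shiftLeft {v w : ℕ} (hw : w < 120)
    (h : v = w ∧ w ∈ S ∨ v = 120 + w ∧ w ∉ S) : Describes (1 <<< v) S := by
  intro u hu
  simp only [Nat.one_shiftLeft, Nat.testBit_two_pow, decide_eq_true_eq]
  rcases h with ⟨rfl, h⟩ | ⟨rfl, h⟩
  · exact ⟨fun e => e ▸ h, fun e => by lia⟩
  · exact ⟨fun e => by lia, fun e => by rwa [← Nat.add_left_cancel e]⟩

theorem Describes.of_search (hS : IsDominating S) {l : List ℕ} (hl : ∀ v ∈ l, v < 120)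
    (h : Describes m S) (hs : search l m) :
    ∃ r c : Fin 5, ∀ v < 120, v ∈ S ↔ color r v = c := by
  induction l generalizing m with
  | nil =>
    obtain ⟨r, c, hrc⟩ := of_decide_eq_true hs
    refine ⟨r, c, fun v hv => ?_⟩
    have := hrc v hv
    split_ifs at this with hc
    · exact iff_of_true ((h v hv).1 this) hc
    · exact iff_of_false ((h v hv).2 this) hc
  | cons v l ih =>
    rw [List.forall_mem_cons] at hl
    simp only [search, ifBit_eq] at hs
    split_ifs at hs
    · exact ih hl.2 h hs
    · exact ih hl.2 h hs
    · rw [Bool.and_eq_true] at hs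
      obtain ⟨m₁, h₁, hs₁⟩ : ∃ m', Describes m' S ∧ propagateThen (search l) m' := by
        by_cases hv : v ∈ S
        · exact (h.or (describes_one_shiftLeft hl.1 (.inl ⟨rfl, hv⟩))).of_propagateThen hS hs.1
        · exact (h.or (describes_one_shiftLeft hl.1 (.inr ⟨rfl, hv⟩))).of_propagateThen hS hs.2
      obtain ⟨m₂, h₂, hs₂⟩ := h₁.of_propagateThen hS hs₁
      exact ih hl.2 h₂ hs₂

theorem IsDominating.exists_color (hS : IsDominating S) :
    ∃ r c : Fin 5, ∀ v < 120, v ∈ S ↔ color r v = c :=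
  Describes.of_search hS (by simp) (fun v _ => by simp) search_eq_true

theorem countP_le_indepBound {P : ℕ → Bool} (hP : ∀ i j, P i → P j → ¬ adj i j) (l : List ℕ)
    {banned : ℕ} (h : ∀ i, banned.testBit i → ¬ P i) : l.countP P ≤ indepBound banned l := by
  induction l generalizing banned with
  | nil => simp
  | cons v l ih =>
    rw [indepBound, List.countP_cons]
    split_ifs with hv hb hb
    · exact absurd hv (h v hb)
    · refine le_max_of_le_right (Nat.add_le_add_right (ih fun i hi => ?_) 1)
      rw [Nat.testBit_or, Bool.or_eq_true] at hi
      exact hi.elim (h i) fun hi hPi => hP v i hv hPi hi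
    · exact ih h
    · exact le_max_of_le_left (ih h)

/-- Each color class of a proper 5-coloring satisfies the constraints of the search. -/
theorem isDominating_of_coloring {g : ℕ → Fin 5}
    (hg : ∀ i < 120, ∀ j < 120, adj i j → g i ≠ g j) (c : Fin 5) :
    IsDominating {i ∈ Finset.range 120 | g i = c} where
  lt i hi := by simp_all
  indep i hi j hj h := by
    simp only [Finset.mem_filter, Finset.mem_range] at hi hj
    exact hg i hi.1 j hj.1 h (hi.2.trans hj.2.symm)
  three_le i hi hic := by
    have hic : g i ≠ c := by simpa [hi] using hic
    have hle (d : Fin 5) : ({j ∈ (nbrs i).toFinset | g j = d}).card ≤ 3 := by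
      rw [show {j ∈ (nbrs i).toFinset | g j = d} = ((nbrs i).filter (g · = d)).toFinset by
        ext; simp, List.toFinset_card_of_nodup ((nodup_nbrs i).filter _),
        ← List.countP_eq_length_filter]
      refine le_trans (List.countP_mono_left fun j hj hd => ?_)
        ((countP_le_indepBound (P := fun j => decide (j < 120 ∧ g j = d)) ?_ (nbrs i)
          (banned := 0) (by simp)).trans (indepBound_nbrs i hi))
      · simpa [lt_of_adj (mem_nbrs.1 hj)] using hd
      · simp only [decide_eq_true_eq]
        exact fun j k hj hk h => hg j hj.1 k hk.1 h (hj.2.trans hk.2.symm)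
    have hsum : ∑ d, ({j ∈ (nbrs i).toFinset | g j = d}).card = 12 := by
      rw [← Finset.card_eq_sum_card_fiberwise (by simp), List.toFinset_card_of_nodup (nodup_nbrs i),
        length_nbrs i hi]
    have h0 : ({j ∈ (nbrs i).toFinset | g j = g i}).card = 0 := by
      rw [Finset.card_eq_zero, Finset.filter_eq_empty_iff]
      intro j hj he
      rw [List.mem_toFinset, mem_nbrs] at hj
      exact hg i hi j (lt_of_adj hj) hj he.symm
    have hset : ({j ∈ {j ∈ Finset.range 120 | g j = c} | adj i j} : Finset ℕ) =
        {j ∈ (nbrs i).toFinset | g j = c} := by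
      ext j
      simp only [Finset.mem_filter, Finset.mem_range, List.mem_toFinset, mem_nbrs]
      exact ⟨fun h => ⟨h.2, h.1.2⟩, fun h => ⟨⟨lt_of_adj h.1, h.2⟩, h.1⟩⟩
    rw [hset]
    have hrest : ∑ d ∈ (Finset.univ.erase (g i)).erase c,
        ({j ∈ (nbrs i).toFinset | g j = d}).card ≤ 9 := by
      refine (Finset.sum_le_card_nsmul _ _ 3 fun d _ => hle d).trans ?_
      simp [Finset.card_erase_of_mem, hic.symm]
    rw [← Finset.add_sum_erase _ _ (Finset.mem_univ (g i)),
      ← Finset.add_sum_erase _ _ (Finset.mem_erase.2 ⟨hic.symm, Finset.mem_univ c⟩)] at hsum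
    lia

/-- The real number represented by an element of `ℤ[φ]`. -/
noncomputable def val (p : ℤ × ℤ) : ℝ := p.1 + p.2 * gr

theorem gr_sq : gr ^ 2 = gr + 1 := Real.goldenRatio_sq

theorem one_lt_gr : 1 < gr := Real.one_lt_goldenRatio

theorem val_injective : Function.Injective val := by
  intro p q h
  have hirr : Irrational gr := Real.goldenRatio_irrational
  have h2 : p.2 = q.2 := by
    by_contra hne
    refine ((hirr.intCast_mul (sub_ne_zero.2 hne)).add_intCast (p.1 - q.1)).ne_zero ?_
    simp only [val] at h
    push_cast
    linarith
  refine Prod.ext ?_ h2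
  simpa [val, h2] using h

/-- The quaternion with the doubled coordinates `u`. -/
noncomputable def toQuaternion (u : Fin 4 → ℤ × ℤ) : Quaternion ℝ :=
  ⟨val (u 0) / 2, val (u 1) / 2, val (u 2) / 2, val (u 3) / 2⟩

theorem coords_toQuaternion (u : Fin 4 → ℤ × ℤ) :
    coords (toQuaternion u) = fun k => val (u k) / 2 := by
  ext k
  fin_cases k <;> rfl

theorem coords_injective : Function.Injective coords := by
  intro p q h
  exact QuaternionAlgebra.ext (congrFun h 0) (congrFun h 1) (congrFun h 2) (congrFun h 3)

theorem toQuaternion_injective : Function.Injective toQuaternion := by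
  intro u w h
  have := congrArg coords h
  simp only [coords_toQuaternion] at this
  ext1 k
  exact val_injective (by simpa using congrFun this k)

theorem norm_toQuaternion_sub (u w : Fin 4 → ℤ × ℤ) :
    ‖toQuaternion u - toQuaternion w‖ = gr - 1 ↔ sqDist u w = (8, -4) := by
  have key : ‖toQuaternion u - toQuaternion w‖ ^ 2 = val (sqDist u w) / 4 := by
    rw [pow_two, ← Quaternion.normSq_eq_norm_mul_self, Quaternion.normSq_def', Quaternion.re_sub,
      Quaternion.imI_sub, Quaternion.imJ_sub, Quaternion.imK_sub]
    simp only [toQuaternion, sqDist, square, val, Prod.fst_add, Prod.snd_add, Prod.fst_sub,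
      Prod.snd_sub]
    push_cast
    linear_combination (((u 0).2 - (w 0).2 : ℝ) ^ 2 + ((u 1).2 - (w 1).2) ^ 2 +
      ((u 2).2 - (w 2).2) ^ 2 + ((u 3).2 - (w 3).2) ^ 2) / 4 * gr_sq
  rw [← pow_left_inj₀ (norm_nonneg _) (sub_nonneg.2 one_lt_gr.le) two_ne_zero, key,
    ← val_injective.eq_iff, div_eq_iff (by norm_num)]
  have : (gr - 1) ^ 2 * 4 = val (8, -4) := by
    simp only [val]
    push_cast
    linear_combination 4 * gr_sq
  rw [this]

theorem isSign_intCast (s : ℤˣ) : IsSign (s : ℤ) := by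
  rcases Int.units_eq_one_or s with rfl | rfl <;> simp [IsSign]

theorem exists_units_of_isSign {x : ℝ} (hx : IsSign x) : ∃ s : ℤˣ, x = (s : ℤ) := by
  rcases hx with rfl | rfl
  exacts [⟨1, by simp⟩, ⟨-1, by simp⟩]

theorem inv_two_mul_gr (x : ℝ) : x / (2 * gr) = (-x + x * gr) / 2 := by
  have : gr ≠ 0 := (zero_lt_one.trans one_lt_gr).ne'
  field_simp
  linear_combination -x * gr_sq

theorem coords_toQuaternion_cons (a b c d : ℤ × ℤ) :
    coords (toQuaternion ![a, b, c, d]) = ![val a / 2, val b / 2, val c / 2, val d / 2] := rfl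

theorem coords_toQuaternion_comp (u : Fin 4 → ℤ × ℤ) (σ : Equiv.Perm (Fin 4)) :
    coords (toQuaternion (u ∘ σ)) = coords (toQuaternion u) ∘ σ := by
  simp only [coords_toQuaternion]
  rfl

theorem toQuaternion_mem {u : Fin 4 → ℤ × ℤ} (hu : IsVertex u) : toQuaternion u ∈ V600 := by
  rcases hu with ⟨s, hu⟩ | ⟨s₀, s₁, s₂, s₃, rfl⟩ | ⟨s₁, s₂, s₃, σ, hσ, rfl⟩
  · refine .inl ⟨(s : ℤ), isSign_intCast s, ?_⟩
    rcases hu with rfl | rfl | rfl | rfl <;> simp [coords_toQuaternion_cons, val]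
  · refine .inr (.inl ⟨_, _, _, _, isSign_intCast s₀, isSign_intCast s₁, isSign_intCast s₂,
      isSign_intCast s₃, ?_⟩)
    simp [coords_toQuaternion_cons, val]
  · refine .inr (.inr ⟨_, _, _, isSign_intCast s₁, isSign_intCast s₂, isSign_intCast s₃, σ, hσ, ?_⟩)
    rw [coords_toQuaternion_comp, coords_toQuaternion_cons, inv_two_mul_gr]
    simp [val]

theorem exists_toQuaternion_vec {q : Quaternion ℝ} (hq : q ∈ V600) :
    ∃ i < 120, toQuaternion (vec i) = q := by
  suffices ∃ i < 120, coords (toQuaternion (vec i)) = coords q by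
    obtain ⟨i, hi, h⟩ := this
    exact ⟨i, hi, coords_injective h⟩
  rcases hq with ⟨ε, hε, h⟩ | ⟨ε₀, ε₁, ε₂, ε₃, h₀, h₁, h₂, h₃, h⟩ |
    ⟨ε₁, ε₂, ε₃, h₁, h₂, h₃, σ, hσ, h⟩
  · obtain ⟨s, rfl⟩ := exists_units_of_isSign hε
    obtain ⟨⟨i₀, hi₀, e₀⟩, ⟨i₁, hi₁, e₁⟩, ⟨i₂, hi₂, e₂⟩, i₃, hi₃, e₃⟩ := exists_vec_axis s
    rcases h with h | h | h | h
    exacts [⟨i₀, hi₀, by simp [h, e₀, coords_toQuaternion_cons, val]⟩,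
      ⟨i₁, hi₁, by simp [h, e₁, coords_toQuaternion_cons, val]⟩,
      ⟨i₂, hi₂, by simp [h, e₂, coords_toQuaternion_cons, val]⟩,
      ⟨i₃, hi₃, by simp [h, e₃, coords_toQuaternion_cons, val]⟩]
  · obtain ⟨s₀, rfl⟩ := exists_units_of_isSign h₀
    obtain ⟨s₁, rfl⟩ := exists_units_of_isSign h₁
    obtain ⟨s₂, rfl⟩ := exists_units_of_isSign h₂
    obtain ⟨s₃, rfl⟩ := exists_units_of_isSign h₃
    obtain ⟨i, hi, e⟩ := exists_vec_half s₀ s₁ s₂ s₃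
    exact ⟨i, hi, by simp [h, e, coords_toQuaternion_cons, val]⟩
  · obtain ⟨s₁, rfl⟩ := exists_units_of_isSign h₁
    obtain ⟨s₂, rfl⟩ := exists_units_of_isSign h₂
    obtain ⟨s₃, rfl⟩ := exists_units_of_isSign h₃
    obtain ⟨i, hi, e⟩ := exists_vec_golden s₁ s₂ s₃ σ hσ
    refine ⟨i, hi, ?_⟩
    rw [h, e, coords_toQuaternion_comp, coords_toQuaternion_cons, inv_two_mul_gr]
    simp [val]

/-- The vertices of the 600-cell, indexed by the numbers less than 120. -/
noncomputable def vertexEquiv : Fin 120 ≃ V600 :=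
  .ofBijective (fun i => ⟨toQuaternion (vec i), toQuaternion_mem (isVertex_vec i i.2)⟩)
    ⟨fun i j h => Fin.ext <| vec_inj i i.2 j j.2 <| toQuaternion_injective <| congrArg Subtype.val h,
      fun q => by
        obtain ⟨i, hi, h⟩ := exists_toQuaternion_vec q.2
        exact ⟨⟨i, hi⟩, Subtype.ext h⟩⟩

theorem adj_vertexEquiv (i j : Fin 120) :
    sigma600.Adj (vertexEquiv i) (vertexEquiv j) ↔ adj i j := by
  have h : ‖(vertexEquiv i : Quaternion ℝ) - vertexEquiv j‖ = gr - 1 ↔ adj i j := by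
    rw [adj_eq i i.2 j j.2, decide_eq_true_eq]
    exact norm_toQuaternion_sub _ _
  rw [sigma600, SimpleGraph.fromRel_adj, norm_sub_rev (vertexEquiv j : Quaternion ℝ), or_self, h,
    and_iff_right_iff_imp]
  rintro h' he
  rw [← h, he, sub_self, norm_zero] at h'
  exact one_lt_gr.ne (sub_eq_zero.1 h'.symm).symm

/-- The color classes of the five colorings. -/
def colorClass (p : Fin 5 × Fin 5) : Set V600 := {q | color p.1 (vertexEquiv.symm q) = p.2}

theorem colorClass_injective : Function.Injective colorClass := by
  intro p p' h
  have := color_inj p.1 p.2 p'.1 p'.2 fun v hv => by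
    simpa [colorClass] using congrArg (vertexEquiv ⟨v, hv⟩ ∈ ·) h
  exact Prod.ext this.1 this.2

theorem exists_colorClass_eq {f : V600 → Fin 5}
    (hf : ∀ q q' : V600, sigma600.Adj q q' → f q ≠ f q') (c : Fin 5) :
    ∃ p, colorClass p = {q | f q = c} := by
  set g : ℕ → Fin 5 := fun i => f (vertexEquiv (Fin.ofNat 120 i)) with hg
  obtain ⟨r, d, h⟩ := (isDominating_of_coloring (g := g) (fun i hi j hj h => by
    refine hf _ _ ((adj_vertexEquiv _ _).2 ?_)
    simpa [Nat.mod_eq_of_lt, hi, hj] using h) c).exists_color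
  refine ⟨(r, d), Set.ext fun q => ?_⟩
  obtain ⟨i, rfl⟩ := vertexEquiv.surjective q
  simpa [colorClass, hg] using (h i i.2).symm

end SixHundredCell

open SixHundredCell

/-- The collection of color classes of proper 5-colorings of the 600-cell graph has
exactly 25 members (the 25 vertices of B(Σ⁶)). -/
theorem card_color_classes_six_hundred_cell :
    Nat.card {S : Set V600 // ∃ f : V600 → Fin 5,
      (∀ q q' : V600, sigma600.Adj q q' → f q ≠ f q') ∧
      ∃ c : Fin 5, S = {q : V600 | f q = c}} = 25 := by
  have hset : {S : Set V600 | ∃ f : V600 → Fin 5,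
      (∀ q q' : V600, sigma600.Adj q q' → f q ≠ f q') ∧
      ∃ c : Fin 5, S = {q : V600 | f q = c}} = Set.range colorClass := by
    ext S
    constructor
    · rintro ⟨f, hf, c, rfl⟩
      exact exists_colorClass_eq hf c
    · rintro ⟨p, rfl⟩
      refine ⟨fun q => color p.1 (vertexEquiv.symm q), fun q q' h => ?_, p.2, rfl⟩
      rw [← vertexEquiv.apply_symm_apply q, ← vertexEquiv.apply_symm_apply q', adj_vertexEquiv] at h
      exact color_proper _ (Fin.is_lt _) _ (Fin.is_lt _) h p.1
  calc
    _ = Nat.card (Set.range colorClass) := by rw [← hset]; rfl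
    _ = 25 := by rw [Nat.card_range_of_injective colorClass_injective]; simp
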